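/- If x ≤ y in the Bruhat order, then (−1)^{ℓ(x)}·σ(e_{x,y}) is positive in ℝ[z, z⁻¹], i.e. σ(e_{x,y}) = a·z^{−ℓ(y)} with (−1)^{ℓ(x)}·a > 0. -/

import Mathlib

/-!
Common framework: a Coxeter system `(W, S)` (encoded via Mathlib's
`CoxeterSystem`, with `S = {simple s : s ∈ B}`), the Bruhat order on `W`, and
a realisation `(𝔥, 𝔥*, {α_s}, {α_s^∨})` of `(W, S)` over `ℝ`.
-/

noncomputable section

variable {B : Type} {W : Type} [Group W] {M : CoxeterMatrix B}

/-- The strict Bruhat order on `W`: the transitive closure of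
`x < t x` whenever `t` is a reflection with `ℓ(x) < ℓ(t x)`. -/
def BruhatLT (cs : CoxeterSystem M W) : W → W → Prop :=
  Relation.TransGen fun x y =>
    ∃ t : W, cs.IsReflection t ∧ y = t * x ∧ cs.length x < cs.length y

/-- The Bruhat order on `W` (reflexive closure of `BruhatLT`). -/
def BruhatLE (cs : CoxeterSystem M W) : W → W → Prop :=
  Relation.ReflTransGen fun x y =>
    ∃ t : W, cs.IsReflection t ∧ y = t * x ∧ cs.length x < cs.length y

/-- A realisation of `(W, S)` over `ℝ`: a finite-dimensional real vector space
`𝔥 = V` with linearly independent simple roots `{α_s} ⊆ 𝔥*` and simple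
coroots `{α_s^∨} ⊆ 𝔥` satisfying `⟨α_s, α_t^∨⟩ = -2 cos (π / m_{s,t})`
(with `π/m = 0` when `m_{s,t} = ∞`, encoded by `M.M s t = 0`), together with
the (faithful) action of `W` on `𝔥` by `s · v = v - ⟨α_s, v⟩ α_s^∨`. -/
structure Realisation (cs : CoxeterSystem M W) (V : Type) [AddCommGroup V]
    [Module ℝ V] [FiniteDimensional ℝ V] : Type where
  α : B → Module.Dual ℝ V
  coα : B → V
  indep_α : LinearIndependent ℝ α
  indep_coα : LinearIndependent ℝ coα
  pairing : ∀ s t : B, α s (coα t) = -2 * Real.cos (Real.pi / (M.M s t))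
  act : W →* (V →ₗ[ℝ] V)
  act_simple : ∀ (s : B) (v : V), act (cs.simple s) v = v - α s v • coα s
  faithful : Function.Injective act

/-!
### The nil Hecke ring, pointwise

`Q_W = ⊕_x Q δ_x` is modelled pointwise: an element is a finitely supported
family of rational functions on `𝔥`, encoded as actual functions `V → ℝ`
(the divisions by roots being honest on the set `RegSet` of regular points).
Right multiplication by `D_s = (1/α_s)(δ_1 - δ_s)` uses
`(f δ_x) · D_s = f · x(1/α_s) · (δ_x - δ_{x s})`, and
`D_{s_1 ⋯ s_m} = D_{s_1} ⋯ D_{s_m}` is the corresponding iterated product.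
The equivariant multiplicity `e_{x, y}` (for a reduced word `ω` of `y`) is the
`δ_x`-coefficient of `D_y`.
-/

variable {V : Type} [AddCommGroup V] [Module ℝ V] [FiniteDimensional ℝ V]

/-- Right multiplication by `D_s` in (the pointwise model of) `Q_W`. -/
def rightD (cs : CoxeterSystem M W) (r : Realisation cs V)
    (c : W →₀ (V → ℝ)) (s : B) : W →₀ (V → ℝ) :=
  c.sum fun x f =>
    Finsupp.single x (fun v => f v * (r.α s (r.act x⁻¹ v))⁻¹) -
      Finsupp.single (x * cs.simple s) (fun v => f v * (r.α s (r.act x⁻¹ v))⁻¹)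

/-- `D_ω = D_{s_1} D_{s_2} ⋯ D_{s_m}` for a word `ω = s_1 ⋯ s_m`. -/
def nilD (cs : CoxeterSystem M W) (r : Realisation cs V) (l : List B) :
    W →₀ (V → ℝ) :=
  l.foldl (rightD cs r) (Finsupp.single 1 fun _ => (1 : ℝ))

/-- The equivariant multiplicity `e_{x, ω}`: the `δ_x`-coefficient of `D_ω`
(for `ω` a reduced word of `y`, this is `e_{x,y}`), as a rational function
on `𝔥` (honest at regular points). -/
def eqMult (cs : CoxeterSystem M W) (r : Realisation cs V) (x : W)
    (l : List B) : V → ℝ :=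
  nilD cs r l x

/-- The regular points of `𝔥`: those where no root `w(α_s)` vanishes.
(Two rational functions in `Q = R[1/Φ]` are equal iff they agree on this set.) -/
def RegSet (cs : CoxeterSystem M W) (r : Realisation cs V) : Set V :=
  {v | ∀ (w : W) (s : B), r.α s (r.act w v) ≠ 0}

/-- `prodForm ω v = ∏_{i=1}^{m} (α_{s_i}((s_1 ⋯ s_{i-1})⁻¹ v))⁻¹`:
the value at `v` of `∏_{t ∈ L_T(y)} 1/α_t` for a reduced word `ω = s_1 ⋯ s_m`
of `y` (the `α_t` for `t` running over the left inversions `L_T(y)` being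
precisely the roots `s_1 ⋯ s_{i-1}(α_{s_i})`). -/
def prodForm (cs : CoxeterSystem M W) (r : Realisation cs V) :
    List B → V → ℝ
  | [], _ => 1
  | s :: l, v => (r.α s v)⁻¹ * prodForm cs r l (r.act (cs.simple s)⁻¹ v)

section StrongExchange

open Classical in
/-- The action of `s_i` on `W × ℤ/2`: conjugation by `s_i` on the first factor, flipping the second
factor exactly at `s_i`. -/
def signedConj (cs : CoxeterSystem M W) (i : B) : Equiv.Perm (W × ZMod 2) :=
  Function.Involutive.toPerm
    (fun p => (cs.simple i * p.1 * cs.simple i, p.2 + if p.1 = cs.simple i then 1 else 0)) <| by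
    intro p
    have h : cs.simple i * p.1 * cs.simple i = cs.simple i ↔ p.1 = cs.simple i := by
      constructor
      · intro h
        simpa [mul_assoc] using congrArg (fun q => cs.simple i * q * cs.simple i) h
      · intro h; simp [h]
    simp only [h, add_assoc, CharTwo.add_self_eq_zero]
    simp [mul_assoc]

open Classical in
theorem signedConj_apply (cs : CoxeterSystem M W) (i : B) (p : W × ZMod 2) : signedConj cs i p =
    (cs.simple i * p.1 * cs.simple i, p.2 + if p.1 = cs.simple i then 1 else 0) := rfl

open Classical in
theorem prod_signedConj (cs : CoxeterSystem M W) (ω : List B) (p : W × ZMod 2) :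
    (ω.map (signedConj cs)).prod p =
      (cs.wordProd ω * p.1 * (cs.wordProd ω)⁻¹, p.2 + (cs.rightInvSeq ω).count p.1) := by
  induction ω with
  | nil => simp
  | cons i ω ih =>
    have h : (cs.wordProd ω * p.1 * (cs.wordProd ω)⁻¹ = cs.simple i) ↔
        ((cs.wordProd ω)⁻¹ * cs.simple i * cs.wordProd ω = p.1) := by
      constructor
      · intro h; rw [← h]; group
      · intro h; rw [← h]; group
    rw [mul_assoc, mul_assoc] at h
    rw [List.map_cons, List.prod_cons, Equiv.Perm.mul_apply, ih]
    simp only [signedConj_apply, h, cs.wordProd_cons, CoxeterSystem.rightInvSeq, List.count_cons,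
      beq_iff_eq, mul_inv_rev, cs.inv_simple, mul_assoc, Nat.cast_add, Nat.cast_ite, Nat.cast_one,
      Nat.cast_zero, add_assoc]

theorem wordProd_replicate_pair (cs : CoxeterSystem M W) (i j : B) (m : ℕ) :
    cs.wordProd (List.replicate m [i, j]).flatten = (cs.simple i * cs.simple j) ^ m := by
  induction m with
  | zero => simp
  | succ m ih => simp [List.replicate_succ, cs.wordProd_cons, ih, pow_succ', mul_assoc]

/-- The right inversion sequence of `(i j)^m` lists the reflections `(s_j s_i)^k s_j`,
`k = 2m - 1, …, 0`. -/
theorem rightInvSeq_replicate_pair (cs : CoxeterSystem M W) (i j : B) (m : ℕ) :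
    cs.rightInvSeq (List.replicate m [i, j]).flatten =
      ((List.range (2 * m)).map
        fun k => (cs.simple j * cs.simple i) ^ k * cs.simple j).reverse := by
  induction m with
  | zero => simp
  | succ m ih =>
    have hinv : ((cs.simple i * cs.simple j) ^ m)⁻¹ = (cs.simple j * cs.simple i) ^ m := by
      rw [← inv_pow]; simp
    have hconj : ∀ n : ℕ, cs.simple j * (cs.simple i * cs.simple j) ^ n =
        (cs.simple j * cs.simple i) ^ n * cs.simple j := fun n => by
      induction n with
      | zero => simp
      | succ n ih => rw [pow_succ, ← mul_assoc, ih, pow_succ]; simp only [mul_assoc]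
    rw [List.replicate_succ, List.flatten_cons, List.cons_append, List.cons_append,
      List.nil_append, CoxeterSystem.rightInvSeq, CoxeterSystem.rightInvSeq, ih,
      show 2 * (m + 1) = 2 * m + 1 + 1 by ring, List.range_succ, List.range_succ]
    simp only [cs.wordProd_cons, wordProd_replicate_pair, mul_inv_rev, cs.inv_simple, hinv,
      List.map_append, List.map_cons, List.map_nil, List.reverse_append, List.reverse_cons,
      List.reverse_nil, List.nil_append, List.cons_append]
    congr 1
    · rw [mul_assoc, mul_assoc, hconj]
      rw [show 2 * m + 1 = m + 1 + m by ring, pow_add, pow_succ]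
      simp only [mul_assoc]
    · congr 1
      rw [mul_assoc, hconj, ← mul_assoc, ← pow_add, two_mul]

theorem signedConj_isLiftable (cs : CoxeterSystem M W) : M.IsLiftable (signedConj cs) := by
  classical
  intro i j
  have h : (signedConj cs i * signedConj cs j) ^ M i j =
      ((List.replicate (M i j) [i, j]).flatten.map (signedConj cs)).prod := by
    induction M i j with
    | zero => simp
    | succ m ih => rw [pow_succ', ih]; simp [List.replicate_succ, mul_assoc]
  rw [h]
  ext1 p
  rw [prod_signedConj, wordProd_replicate_pair, rightInvSeq_replicate_pair, two_mul,
    List.range_add, cs.simple_mul_simple_pow]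
  have hper : ∀ k, (cs.simple j * cs.simple i) ^ (M i j + k) = (cs.simple j * cs.simple i) ^ k :=
    fun k => by rw [pow_add, cs.simple_mul_simple_pow', one_mul]
  simp only [List.map_append, List.map_map, Function.comp_def, hper, List.count_reverse,
    List.count_append, Nat.cast_add, CharTwo.add_self_eq_zero]
  simp

/-- The strong exchange property, for right inversions. -/
theorem mem_rightInvSeq_of_isRightInversion (cs : CoxeterSystem M W) {t : W} {ω : List B}
    (h : cs.IsRightInversion (cs.wordProd ω) t) : t ∈ cs.rightInvSeq ω := by
  classical
  set Φ := cs.lift ⟨signedConj cs, signedConj_isLiftable cs⟩ with hΦ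
  have hword : ∀ (ω : List B) (p : W × ZMod 2), Φ (cs.wordProd ω) p =
      (cs.wordProd ω * p.1 * (cs.wordProd ω)⁻¹, p.2 + (cs.rightInvSeq ω).count p.1) := by
    intro ω p
    rw [← prod_signedConj, CoxeterSystem.wordProd, map_list_prod, List.map_map]
    congr 3
    exact funext fun i => cs.lift_apply_simple (signedConj_isLiftable cs) i
  have hshift : ∀ (w x : W) (ε : ZMod 2),
      Φ w (x, ε + 1) = ((Φ w (x, ε)).1, (Φ w (x, ε)).2 + 1) := by
    intro w x ε
    obtain ⟨ω, rfl⟩ := cs.wordProd_surjective w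
    simp only [hword]
    rw [add_right_comm]
  have hrefl : Φ t (t, 0) = (t, 1) := by
    obtain ⟨u, i, rfl⟩ := h.1
    have h1 : (Φ u⁻¹ (u * cs.simple i * u⁻¹, 0)).1 = cs.simple i := by
      obtain ⟨ω, hω⟩ := cs.wordProd_surjective u⁻¹
      rw [← hω, hword, hω]; group
    obtain ⟨ε, hε⟩ : ∃ ε, Φ u⁻¹ (u * cs.simple i * u⁻¹, 0) = (cs.simple i, ε) :=
      ⟨_, Prod.ext h1 rfl⟩
    have h2 : Φ (cs.simple i) (cs.simple i, ε) = (cs.simple i, ε + 1) := by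
      have := hword [i] (cs.simple i, ε)
      simpa using this
    have h3 : Φ u (cs.simple i, ε) = (u * cs.simple i * u⁻¹, 0) := by
      rw [← hε, ← Equiv.Perm.mul_apply, ← map_mul]
      simp
    rw [map_mul, map_mul, Equiv.Perm.mul_apply, Equiv.Perm.mul_apply, hε, h2, hshift, h3, zero_add]
  by_contra hmem
  obtain ⟨ω', hω', hw⟩ := cs.exists_isReduced (cs.wordProd ω * t)
  have h4 : ((cs.rightInvSeq ω').count t : ZMod 2) = 1 := by
    have h5 : Φ (cs.wordProd ω * t) (t, 0) = Φ (cs.wordProd ω) (t, 1) := by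
      rw [map_mul, Equiv.Perm.mul_apply, hrefl]
    rw [hw, hword, hword, List.count_eq_zero_of_not_mem hmem] at h5
    simpa using congrArg Prod.snd h5
  have h6 : t ∈ cs.rightInvSeq ω' := by
    by_contra h7
    rw [List.count_eq_zero_of_not_mem h7] at h4
    simp at h4
  have h8 := (cs.isRightInversion_of_mem_rightInvSeq hω' h6).2
  rw [← hw, mul_assoc, h.1.mul_self, mul_one] at h8
  exact absurd h.2 h8.not_gt

/-- The strong exchange property, for left inversions. -/
theorem mem_leftInvSeq_of_isLeftInversion (cs : CoxeterSystem M W) {t : W} {ω : List B}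
    (h : cs.IsLeftInversion (cs.wordProd ω) t) : t ∈ cs.leftInvSeq ω := by
  rw [← cs.isRightInversion_inv_iff, ← cs.wordProd_reverse] at h
  simpa [cs.rightInvSeq_reverse] using mem_rightInvSeq_of_isRightInversion cs h

theorem isReduced_concat_iff (cs : CoxeterSystem M W) {ω : List B} (hω : cs.IsReduced ω) (i : B) :
    cs.IsReduced (ω ++ [i]) ↔
      cs.length (cs.wordProd ω) < cs.length (cs.wordProd ω * cs.simple i) := by
  have h1 := hω.eq
  rw [CoxeterSystem.IsReduced, cs.wordProd_append, cs.wordProd_singleton, List.length_append,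
    List.length_singleton]
  rcases cs.length_mul_simple (cs.wordProd ω) i with h | h <;> omega

theorem isReduced_of_concat (cs : CoxeterSystem M W) {ω : List B} {i : B}
    (h : cs.IsReduced (ω ++ [i])) : cs.IsReduced ω := by
  simpa using h.take ω.length

/-- A left inversion of a reduced word is realised by deleting a letter. -/
theorem exists_eraseIdx_of_isLeftInversion (cs : CoxeterSystem M W) {t : W} {ω : List B}
    (h : cs.IsLeftInversion (cs.wordProd ω) t) :
    ∃ k < ω.length, (cs.leftInvSeq ω).getD k 1 = t ∧
      cs.wordProd (ω.eraseIdx k) = t * cs.wordProd ω := by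
  obtain ⟨k, hk, rfl⟩ := List.mem_iff_getElem.mp (mem_leftInvSeq_of_isLeftInversion cs h)
  refine ⟨k, by simpa using hk, List.getD_eq_getElem _ _ hk, ?_⟩
  rw [← List.getD_eq_getElem _ 1 hk, cs.getD_leftInvSeq_mul_wordProd]

end StrongExchange

section Bruhat

theorem BruhatLE.trans {cs : CoxeterSystem M W} {x y z : W} (h : BruhatLE cs x y)
    (h' : BruhatLE cs y z) : BruhatLE cs x z :=
  Relation.ReflTransGen.trans h h'

theorem BruhatLE.of_reflection {cs : CoxeterSystem M W} {x t : W} (ht : cs.IsReflection t)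
    (h : cs.length x < cs.length (t * x)) : BruhatLE cs x (t * x) :=
  Relation.ReflTransGen.single ⟨t, ht, rfl, h⟩

theorem bruhatLE_mul_simple {cs : CoxeterSystem M W} {x : W} {i : B}
    (h : cs.length x < cs.length (x * cs.simple i)) : BruhatLE cs x (x * cs.simple i) := by
  have := BruhatLE.of_reflection (cs := cs) (x := x) (t := x * cs.simple i * x⁻¹) ⟨x, i, rfl⟩
  simp only [inv_mul_cancel_right] at this
  exact this h

theorem mul_simple_bruhatLE {cs : CoxeterSystem M W} {x : W} {i : B}
    (h : cs.length (x * cs.simple i) < cs.length x) : BruhatLE cs (x * cs.simple i) x := by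
  have := bruhatLE_mul_simple (cs := cs) (x := x * cs.simple i) (i := i)
  simp only [cs.simple_mul_simple_cancel_right] at this
  exact this h

theorem length_lt_or_reflection_mul_simple_eq {cs : CoxeterSystem M W} {u t : W}
    (ht : cs.IsReflection t) (h : cs.length u < cs.length (t * u)) (i : B) :
    cs.length (u * cs.simple i) < cs.length (t * u * cs.simple i) ∨ t * u * cs.simple i = u := by
  by_contra! hcon
  obtain ⟨h1, h2⟩ := hcon
  have h3 : cs.length (t * u * cs.simple i) < cs.length (u * cs.simple i) := by
    refine lt_of_le_of_ne h1 ?_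
    rw [mul_assoc]
    exact ht.length_mul_right_ne _
  obtain ⟨ω, hω, rfl⟩ := cs.exists_isReduced u
  have h4 := cs.length_mul_simple (cs.wordProd ω) i
  have h5 := cs.length_mul_simple (t * cs.wordProd ω) i
  have h6 : cs.IsLeftInversion (cs.wordProd (ω ++ [i])) t := by
    refine ⟨ht, ?_⟩
    rw [cs.wordProd_append, cs.wordProd_singleton, ← mul_assoc]
    exact h3
  obtain ⟨k, hk, -, hk'⟩ := exists_eraseIdx_of_isLeftInversion cs h6
  rw [cs.wordProd_append, cs.wordProd_singleton, ← mul_assoc] at hk'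
  rw [List.length_append, List.length_singleton] at hk
  rcases Nat.lt_or_ge k ω.length with hlt | hge
  · rw [List.eraseIdx_append_of_lt_length hlt, cs.wordProd_append, cs.wordProd_singleton] at hk'
    have h7 := mul_right_cancel hk'
    have h8 := cs.length_wordProd_le (ω.eraseIdx k)
    rw [h7] at h8
    have h9 := List.length_eraseIdx_add_one hlt
    have h10 := hω.eq
    omega
  · obtain rfl : k = ω.length := by omega
    rw [List.eraseIdx_append_of_length_le le_rfl] at hk'
    simp at hk'
    exact h2 hk'.symm

/-- If `u ≤ w`, then `u s ≤ w` or `u s ≤ w s`. -/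
theorem BruhatLE.mul_simple {cs : CoxeterSystem M W} {u w : W} (h : BruhatLE cs u w) (i : B) :
    BruhatLE cs (u * cs.simple i) w ∨ BruhatLE cs (u * cs.simple i) (w * cs.simple i) := by
  induction h using Relation.ReflTransGen.head_induction_on with
  | refl => exact Or.inr Relation.ReflTransGen.refl
  | head hstep hle ih =>
    obtain ⟨t, ht, rfl, hlt⟩ := hstep
    rcases length_lt_or_reflection_mul_simple_eq ht hlt i with h1 | h1
    · have h2 := BruhatLE.of_reflection (cs := cs) ht (by rwa [← mul_assoc])
      rw [← mul_assoc] at h2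
      exact ih.imp h2.trans h2.trans
    · left
      rw [← h1, cs.simple_mul_simple_cancel_right]
      exact hle

/-- If `u ≤ w`, then `u ≤ w s` or `u s ≤ w s`. -/
theorem BruhatLE.le_mul_simple {cs : CoxeterSystem M W} {u w : W} (h : BruhatLE cs u w) (i : B) :
    BruhatLE cs u (w * cs.simple i) ∨ BruhatLE cs (u * cs.simple i) (w * cs.simple i) := by
  induction h with
  | refl => exact Or.inr Relation.ReflTransGen.refl
  | tail hle hstep ih =>
    obtain ⟨t, ht, rfl, hlt⟩ := hstep
    rcases length_lt_or_reflection_mul_simple_eq ht hlt i with h1 | h1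
    · have h2 := BruhatLE.of_reflection (cs := cs) ht (by rwa [← mul_assoc])
      rw [← mul_assoc] at h2
      exact ih.imp (·.trans h2) (·.trans h2)
    · left
      rw [h1]
      exact hle

/-- The Bruhat order is graded: below `y`, any `x ≠ y` lies below a coatom of `y`. -/
theorem BruhatLE.exists_covered {cs : CoxeterSystem M W} {x y : W} (h : BruhatLE cs x y)
    (hne : x ≠ y) : ∃ t, cs.IsReflection t ∧ cs.length (t * y) + 1 = cs.length y ∧
      BruhatLE cs x (t * y) := by
  induction hn : cs.length y using Nat.strong_induction_on generalizing x y with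
  | _ n ih =>
  subst hn
  have hy : y ≠ 1 := by
    rintro rfl
    rcases Relation.ReflTransGen.cases_tail h with h1 | ⟨z, -, t, -, -, hlt⟩
    · exact hne h1.symm
    · simp at hlt
  obtain ⟨i, hi⟩ := cs.exists_rightDescent_of_ne_one hy
  have hi' := (cs.isRightDescent_iff).mp hi
  set w := y * cs.simple i with hw
  have hyw : y = w * cs.simple i := by simp [hw]
  have hcov : BruhatLE cs x w → ∃ t, cs.IsReflection t ∧
      cs.length (t * y) + 1 = cs.length y ∧ BruhatLE cs x (t * y) := fun hxw => by
    refine ⟨y * cs.simple i * y⁻¹, ⟨y, i, rfl⟩, ?_⟩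
    rw [inv_mul_cancel_right]
    exact ⟨hi', hxw⟩
  by_cases hx : cs.length x < cs.length (x * cs.simple i)
  · apply hcov
    rcases h.le_mul_simple i with h1 | h1
    · exact h1
    · exact (bruhatLE_mul_simple hx).trans h1
  · have hx' : cs.length (x * cs.simple i) < cs.length x :=
      lt_of_le_of_ne (not_lt.mp hx) (cs.length_mul_simple_ne x i)
    have hxw : BruhatLE cs (x * cs.simple i) w := by
      rcases h.le_mul_simple i with h1 | h1
      · exact (mul_simple_bruhatLE hx').trans h1
      · exact h1
    have hne' : x * cs.simple i ≠ w := fun heq => hne (mul_right_cancel heq)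
    obtain ⟨t, ht, hlen, hle⟩ := ih (cs.length w) (by omega) hxw hne' rfl
    have hdisj := hle.mul_simple i
    rw [cs.simple_mul_simple_cancel_right] at hdisj
    rcases cs.length_mul_simple (t * w) i with hup | hdown
    · refine ⟨t, ht, ?_, ?_⟩
      · rw [hyw, ← mul_assoc, hup]
        rw [← hyw]
        omega
      · rw [hyw, ← mul_assoc]
        rcases hdisj with h1 | h1
        · exact h1.trans (bruhatLE_mul_simple (by omega))
        · exact h1
    · apply hcov
      have htw : BruhatLE cs (t * w) w := by
        have hw' : w = t * (t * w) := by rw [← mul_assoc, ht.mul_self, one_mul]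
        conv_rhs => rw [hw']
        exact BruhatLE.of_reflection ht (by rw [← hw']; omega)
      rcases hdisj with h1 | h1
      · exact h1.trans htw
      · exact (h1.trans (mul_simple_bruhatLE (by omega))).trans htw

end Bruhat

section Positivity

/-- The Chebyshev-type recursion giving the coefficients of the roots in a rank two system. -/
def dihedralCoeff (c : ℝ) : ℕ → ℝ
  | 0 => 0
  | 1 => 1
  | k + 2 => c * dihedralCoeff c (k + 1) - dihedralCoeff c k

theorem sin_mul_dihedralCoeff (θ : ℝ) (k : ℕ) :
    Real.sin θ * dihedralCoeff (2 * Real.cos θ) k = Real.sin (k * θ) := by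
  induction k using Nat.strong_induction_on with
  | _ k ih =>
  match k with
  | 0 => simp [dihedralCoeff]
  | 1 => simp [dihedralCoeff]
  | k + 2 =>
    have h1 := ih (k + 1) (by omega)
    have h0 := ih k (by omega)
    have e0 : ((k : ℕ) : ℝ) * θ = ((k + 1 : ℕ) : ℝ) * θ - θ := by push_cast; ring
    have e2 : ((k + 2 : ℕ) : ℝ) * θ = ((k + 1 : ℕ) : ℝ) * θ + θ := by push_cast; ring
    rw [e0, Real.sin_sub] at h0
    rw [e2, Real.sin_add, dihedralCoeff]
    linear_combination 2 * Real.cos θ * h1 - h0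

theorem dihedralCoeff_two (k : ℕ) : dihedralCoeff 2 k = k := by
  induction k using Nat.strong_induction_on with
  | _ k ih =>
  match k with
  | 0 => simp [dihedralCoeff]
  | 1 => simp [dihedralCoeff]
  | k + 2 =>
    rw [dihedralCoeff, ih (k + 1) (by omega), ih k (by omega)]
    push_cast
    ring

theorem dihedralCoeff_pos {m k : ℕ} (hk : 0 < k) (hm : m ≠ 0 → k < m) :
    0 < dihedralCoeff (2 * Real.cos (Real.pi / m)) k := by
  rcases eq_or_ne m 0 with rfl | hm0
  · have : (2 : ℝ) * Real.cos (Real.pi / (0 : ℕ)) = 2 := by simp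
    rw [this, dihedralCoeff_two]
    exact_mod_cast hk
  · have hkm := hm hm0
    have hmpos : (0 : ℝ) < m := by exact_mod_cast Nat.pos_of_ne_zero hm0
    have hpi := Real.pi_pos
    have hsin : 0 < Real.sin (Real.pi / m) := by
      apply Real.sin_pos_of_pos_of_lt_pi (by positivity)
      rw [div_lt_iff₀ hmpos]
      have : (1 : ℝ) < m := by exact_mod_cast (by omega : 1 < m)
      nlinarith
    have hsink : 0 < Real.sin (k * (Real.pi / m)) := by
      have hk' : (0 : ℝ) < k := by exact_mod_cast hk
      apply Real.sin_pos_of_pos_of_lt_pi (by positivity)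
      rw [← mul_div_assoc, div_lt_iff₀ hmpos]
      have : (k : ℝ) < m := by exact_mod_cast hkm
      nlinarith
    rw [← sin_mul_dihedralCoeff] at hsink
    exact (mul_pos_iff_of_pos_left hsin).mp hsink

theorem dihedralCoeff_succ_nonneg {m k : ℕ} (hm1 : m ≠ 1) (hm : m ≠ 0 → k + 1 ≤ m) :
    0 ≤ dihedralCoeff (2 * Real.cos (Real.pi / m)) (k + 1) := by
  by_cases h : m ≠ 0 ∧ k + 1 = m
  · obtain ⟨hm0, rfl⟩ := h
    have hmpos : (0 : ℝ) < (k + 1 : ℕ) := by positivity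
    have hpi := Real.pi_pos
    have hsin : 0 < Real.sin (Real.pi / (k + 1 : ℕ)) := by
      apply Real.sin_pos_of_pos_of_lt_pi (by positivity)
      rw [div_lt_iff₀ hmpos]
      have : (1 : ℝ) < (k + 1 : ℕ) := by exact_mod_cast (by omega : 1 < k + 1)
      nlinarith
    have h1 := sin_mul_dihedralCoeff (Real.pi / (k + 1 : ℕ)) (k + 1)
    rw [mul_div_cancel₀ _ hmpos.ne', Real.sin_pi] at h1
    exact ((mul_eq_zero.mp h1).resolve_left hsin.ne').ge
  · exact (dihedralCoeff_pos (Nat.succ_pos k) fun h0 =>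
      lt_of_le_of_ne (hm h0) fun h1 => h ⟨h0, h1⟩).le

/-- An element without the right descent `a` factors through the dihedral parabolic generated by
`a` and `b`, as a minimal coset representative times an alternating word ending in `b`. -/
theorem exists_mul_alternatingWord (cs : CoxeterSystem M W) (w : W) (a b : B)
    (hw : cs.length w < cs.length (w * cs.simple a)) :
    ∃ (v : W) (k : ℕ), w = v * cs.wordProd (CoxeterSystem.alternatingWord a b k) ∧
      cs.length w = cs.length v + k ∧ cs.length v < cs.length (v * cs.simple a) ∧
      cs.length v < cs.length (v * cs.simple b) := by
  induction hn : cs.length w using Nat.strong_induction_on generalizing w a b with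
  | _ n ih =>
  subst hn
  by_cases hb : cs.length w < cs.length (w * cs.simple b)
  · exact ⟨w, 0, by simp [CoxeterSystem.alternatingWord], rfl, hw, hb⟩
  · have hb' := cs.length_mul_simple w b
    obtain ⟨v, k, h1, h2, h3, h4⟩ :=
      ih (cs.length (w * cs.simple b)) (by omega) (w * cs.simple b) b a
      (by rw [cs.simple_mul_simple_cancel_right]; omega) rfl
    refine ⟨v, k + 1, ?_, by omega, h4, h3⟩
    rw [CoxeterSystem.alternatingWord_succ, cs.wordProd_concat, ← mul_assoc, ← h1,
      cs.simple_mul_simple_cancel_right]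

variable {X : Type} [AddCommGroup X] [Module ℝ X]

theorem map_alternatingWord_apply (cs : CoxeterSystem M W) (R : W →* (X →ₗ[ℝ] X)) (e : B → X)
    (hR : ∀ i j, R (cs.simple i) (e j) = e j + (2 * Real.cos (Real.pi / M.M i j)) • e i)
    (a b : B) (k : ℕ) :
    R (cs.wordProd (CoxeterSystem.alternatingWord a b k)) (e a) =
      if Even k then
        dihedralCoeff (2 * Real.cos (Real.pi / M.M a b)) (k + 1) • e a +
          dihedralCoeff (2 * Real.cos (Real.pi / M.M a b)) k • e b
      else
        dihedralCoeff (2 * Real.cos (Real.pi / M.M a b)) (k + 1) • e b +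
          dihedralCoeff (2 * Real.cos (Real.pi / M.M a b)) k • e a := by
  induction k using Nat.strong_induction_on generalizing a b with
  | _ k ih =>
  have hsymm : ∀ a b, M.M b a = M.M a b := fun a b => M.symmetric b a
  have hself : ∀ a, R (cs.simple a) (e a) = -e a := fun a => by
    rw [hR, show M.M a a = 1 from M.diagonal a]
    simp
    module
  match k with
  | 0 => simp [CoxeterSystem.alternatingWord, dihedralCoeff]
  | 1 => simp [CoxeterSystem.alternatingWord, dihedralCoeff, hR, hsymm a b, add_comm]
  | k + 2 =>
    have h1 := ih (k + 1) (by omega) b a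
    have h0 := ih k (by omega) a b
    rw [CoxeterSystem.alternatingWord_succ, cs.wordProd_concat, map_mul, Module.End.mul_apply, hR,
      map_add, map_smul, h1, CoxeterSystem.alternatingWord_succ, cs.wordProd_concat, map_mul,
      Module.End.mul_apply, hself, map_neg, h0, hsymm a b]
    by_cases hk : Even k
    · have hk1 : ¬ Even (k + 1) := by simpa [Nat.even_add_one] using hk
      have hk2 : Even (k + 2) := by simpa [Nat.even_add] using hk
      simp only [hk, hk1, hk2, if_true, if_false, dihedralCoeff]
      module
    · have hk1 : Even (k + 1) := by simpa [Nat.even_add_one] using hk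
      have hk2 : ¬ Even (k + 2) := by simpa [Nat.even_add] using hk
      simp only [hk, hk1, hk2, if_true, if_false, dihedralCoeff]
      module

/-- In a geometric representation, `w` sends the simple root `e_i` to a positive root whenever
`i` is not a right descent of `w`. -/
theorem pos_of_length_lt_mul_simple (cs : CoxeterSystem M W) (R : W →* (X →ₗ[ℝ] X)) (e : B → X)
    (hR : ∀ i j, R (cs.simple i) (e j) = e j + (2 * Real.cos (Real.pi / M.M i j)) • e i)
    (φ : X →ₗ[ℝ] ℝ) (hφ : ∀ i, 0 < φ (e i)) (w : W) (i : B)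
    (hw : cs.length w < cs.length (w * cs.simple i)) : 0 < φ (R w (e i)) := by
  induction hn : cs.length w using Nat.strong_induction_on generalizing w i with
  | _ n ih =>
  subst hn
  by_cases hw1 : w = 1
  · subst hw1; simpa using hφ i
  obtain ⟨j, hj⟩ := cs.exists_rightDescent_of_ne_one hw1
  have hij : i ≠ j := by
    rintro rfl
    exact absurd hj hw.not_gt
  obtain ⟨v, k, hv, hlen, hvi, hvj⟩ := exists_mul_alternatingWord cs w i j hw
  have hk : k ≠ 0 := by
    rintro rfl
    simp only [CoxeterSystem.alternatingWord, CoxeterSystem.wordProd_nil, mul_one] at hv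
    subst hv
    exact absurd hj hvj.not_gt
  have hi := ih (cs.length v) (by omega) v i hvi rfl
  have hj := ih (cs.length v) (by omega) v j hvj rfl
  have hm1 : M.M i j ≠ 1 := M.off_diagonal i j hij
  have hmk : M.M i j ≠ 0 → k + 1 ≤ M.M i j := by
    intro hm0
    by_contra hlt
    have hsymm : M.M j i = M.M i j := M.symmetric j i
    apply cs.not_isReduced_alternatingWord j i (m := k + 1) (by rw [hsymm]; exact hm0)
      (by change M.M j i < k + 1; omega)
    have h1 := cs.length_wordProd_le (CoxeterSystem.alternatingWord j i (k + 1))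
    have h2 := cs.length_mul_le v (cs.wordProd (CoxeterSystem.alternatingWord j i (k + 1)))
    rw [CoxeterSystem.length_alternatingWord] at h1
    rw [CoxeterSystem.alternatingWord_succ, cs.wordProd_concat, ← mul_assoc, ← hv] at h2
    rw [CoxeterSystem.IsReduced, CoxeterSystem.length_alternatingWord]
    rw [CoxeterSystem.alternatingWord_succ, cs.wordProd_concat] at h1 ⊢
    omega
  have hU := dihedralCoeff_succ_nonneg (k := k) hm1 hmk
  have hU' : 0 < dihedralCoeff (2 * Real.cos (Real.pi / M.M i j)) k :=
    dihedralCoeff_pos (Nat.pos_of_ne_zero hk) fun h => hmk h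
  rw [hv, map_mul, Module.End.mul_apply, map_alternatingWord_apply cs R e hR]
  split_ifs
  · simp only [map_add, map_smul, smul_eq_mul]
    exact add_pos_of_nonneg_of_pos (mul_nonneg hU hi.le) (mul_pos hU' hj)
  · simp only [map_add, map_smul, smul_eq_mul]
    exact add_pos_of_nonneg_of_pos (mul_nonneg hU hj.le) (mul_pos hU' hi)

end Positivity

namespace Realisation

variable {cs : CoxeterSystem M W} (r : Realisation cs V)

theorem act_mul_apply (w w' : W) (v : V) : r.act (w * w') v = r.act w (r.act w' v) := by
  rw [map_mul, Module.End.mul_apply]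

theorem act_mul_simple_inv (x : W) (s : B) (v : V) :
    r.act (x * cs.simple s)⁻¹ v = r.act x⁻¹ v - r.α s (r.act x⁻¹ v) • r.coα s := by
  rw [mul_inv_rev, cs.inv_simple, r.act_mul_apply, r.act_simple]

theorem pairing_self (s : B) : r.α s (r.coα s) = 2 := by
  rw [r.pairing, show M.M s s = 1 from M.diagonal s]
  simp

theorem α_act_mul_simple_inv (x : W) (s : B) (v : V) :
    r.α s (r.act (x * cs.simple s)⁻¹ v) = -r.α s (r.act x⁻¹ v) := by
  rw [r.act_mul_simple_inv, map_sub, map_smul, r.pairing_self, smul_eq_mul]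
  ring

theorem coroot_pos {l : Module.Dual ℝ V} (hl : ∀ s, 0 < l (r.coα s)) {w : W} {s : B}
    (h : cs.length w < cs.length (w * cs.simple s)) : 0 < l (r.act w (r.coα s)) := by
  refine pos_of_length_lt_mul_simple cs r.act r.coα (fun i j => ?_) l hl w s h
  rw [r.act_simple, r.pairing]
  module

theorem root_pos {v : V} (hv : ∀ s, 0 < r.α s v) {w : W} {s : B}
    (h : cs.length w < cs.length (w * cs.simple s)) : 0 < r.α s (r.act w⁻¹ v) := by
  refine pos_of_length_lt_mul_simple cs (Representation.dual (r.act : Representation ℝ W V)) r.α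
    (fun i j => ?_) (Module.Dual.eval ℝ V v) hv w s h
  have hsymm : M.M j i = M.M i j := M.symmetric j i
  ext u
  change r.α j (r.act (cs.simple i)⁻¹ u) = r.α j u + (2 * Real.cos (Real.pi / M.M i j)) * r.α i u
  rw [cs.inv_simple, r.act_simple, map_sub, map_smul, r.pairing, hsymm, smul_eq_mul]
  ring

theorem root_ne_zero {v : V} (hv : ∀ s, 0 < r.α s v) (w : W) (s : B) :
    r.α s (r.act w⁻¹ v) ≠ 0 := by
  rcases cs.length_mul_simple w s with h | h
  · exact (r.root_pos hv (by omega)).ne'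
  · have := r.root_pos hv (w := w * cs.simple s) (s := s) (by
      rw [cs.simple_mul_simple_cancel_right]; omega)
    rw [r.α_act_mul_simple_inv] at this
    linarith

/-- A root and its coroot have the same coordinates with respect to the simple (co)roots. -/
theorem exists_root_coroot_coeff (w : W) (s : B) : ∃ c : B →₀ ℝ,
    r.act w (r.coα s) = Finsupp.linearCombination ℝ r.coα c ∧
      ∀ v, r.α s (r.act w⁻¹ v) = Finsupp.linearCombination ℝ r.α c v := by
  induction w using cs.simple_induction_left with
  | one => exact ⟨Finsupp.single s 1, by simp⟩
  | mul_simple_left w i ih =>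
    obtain ⟨c, h1, h2⟩ := ih
    have hpair : r.α i (Finsupp.linearCombination ℝ r.coα c) =
        Finsupp.linearCombination ℝ r.α c (r.coα i) := by
      simp only [Finsupp.linearCombination_apply, Finsupp.sum, map_sum, map_smul,
        LinearMap.sum_apply, LinearMap.smul_apply]
      refine Finset.sum_congr rfl fun j _ => ?_
      rw [r.pairing, r.pairing, show M.M i j = M.M j i from M.symmetric i j]
    refine ⟨c - Finsupp.single i (r.α i (Finsupp.linearCombination ℝ r.coα c)), ?_, fun v => ?_⟩
    · rw [r.act_mul_apply, h1, r.act_simple, map_sub, Finsupp.linearCombination_single]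
    · rw [mul_inv_rev, cs.inv_simple, r.act_mul_apply, h2, r.act_simple, map_sub, map_smul,
        map_sub, LinearMap.sub_apply, Finsupp.linearCombination_single, LinearMap.smul_apply, hpair,
        smul_eq_mul, smul_eq_mul, mul_comm]

theorem act_reflection (u : W) (s : B) (v : V) :
    r.act (u * cs.simple s * u⁻¹) v = v - r.α s (r.act u⁻¹ v) • r.act u (r.coα s) := by
  rw [r.act_mul_apply, r.act_mul_apply, r.act_simple, map_sub, map_smul, ← r.act_mul_apply,
    mul_inv_cancel, map_one, Module.End.one_apply]

/-- The positive root of a reflection is well defined. -/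
theorem root_eq_of_reflection_eq {v : V} (hv : ∀ s, 0 < r.α s v) {u u' : W} {s s' : B}
    (h : cs.length u < cs.length (u * cs.simple s))
    (h' : cs.length u' < cs.length (u' * cs.simple s'))
    (heq : u * cs.simple s * u⁻¹ = u' * cs.simple s' * u'⁻¹) :
    r.α s (r.act u⁻¹ v) = r.α s' (r.act u'⁻¹ v) := by
  have hp := r.root_pos hv h
  have hp' := r.root_pos hv h'
  obtain ⟨c, h1, h2⟩ := r.exists_root_coroot_coeff u s
  obtain ⟨c', h1', h2'⟩ := r.exists_root_coroot_coeff u' s'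
  have h3 := congrArg (fun t => r.act t v) heq
  simp only [r.act_reflection, sub_right_inj, h1, h1'] at h3
  rw [← map_smul, ← map_smul] at h3
  have h4 := r.indep_coα h3
  have h5 := congrArg (fun d => Finsupp.linearCombination ℝ r.α d v) h4
  simp only [map_smul, LinearMap.smul_apply, ← h2, ← h2', smul_eq_mul] at h5
  nlinarith

open Classical in
/-- The value at `v` of the positive root attached to a reflection `t`. -/
def reflectionRoot (v : V) (t : W) : ℝ :=
  if h : ∃ p : W × B, t = p.1 * cs.simple p.2 * p.1⁻¹ ∧
      cs.length p.1 < cs.length (p.1 * cs.simple p.2) then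
    r.α h.choose.2 (r.act h.choose.1⁻¹ v)
  else 0

theorem reflectionRoot_eq {v : V} (hv : ∀ s, 0 < r.α s v) {u : W} {s : B}
    (h : cs.length u < cs.length (u * cs.simple s)) :
    r.reflectionRoot v (u * cs.simple s * u⁻¹) = r.α s (r.act u⁻¹ v) := by
  have hex : ∃ p : W × B, u * cs.simple s * u⁻¹ = p.1 * cs.simple p.2 * p.1⁻¹ ∧
      cs.length p.1 < cs.length (p.1 * cs.simple p.2) := ⟨(u, s), rfl, h⟩
  rw [reflectionRoot, dif_pos hex]
  exact r.root_eq_of_reflection_eq hv hex.choose_spec.2 h hex.choose_spec.1.symm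

theorem reflectionRoot_pos {v : V} (hv : ∀ s, 0 < r.α s v) {t : W} (ht : cs.IsReflection t) :
    0 < r.reflectionRoot v t := by
  obtain ⟨u, s, rfl⟩ := ht
  rcases cs.length_mul_simple u s with h | h
  · rw [r.reflectionRoot_eq hv (by omega)]
    exact r.root_pos hv (by omega)
  · have hlt : cs.length (u * cs.simple s) < cs.length (u * cs.simple s * cs.simple s) := by
      rw [cs.simple_mul_simple_cancel_right]; omega
    have heq : u * cs.simple s * u⁻¹ = u * cs.simple s * cs.simple s * (u * cs.simple s)⁻¹ := by
      simp [mul_assoc]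
    rw [heq, r.reflectionRoot_eq hv hlt]
    exact r.root_pos hv hlt

/-- Pairing the inverse orbit of a dominant `v` with a dominant weight is strictly decreasing along
the Bruhat order. -/
theorem weight_lt_of_isLeftInversion {v : V} (hv : ∀ s, 0 < r.α s v) {l : Module.Dual ℝ V}
    (hl : ∀ s, 0 < l (r.coα s)) {y t : W} (h : cs.IsLeftInversion y t) :
    l (r.act y⁻¹ v) < l (r.act (t * y)⁻¹ v) := by
  obtain ⟨ω, hω, rfl⟩ := cs.exists_isReduced y
  obtain ⟨k, hk, -, hprod⟩ := exists_eraseIdx_of_isLeftInversion cs h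
  have hsplit : ω = ω.take k ++ ω[k] :: ω.drop (k + 1) := by
    rw [← List.drop_eq_getElem_cons, List.take_append_drop]
  have hpre : cs.IsReduced (ω.take k ++ [ω[k]]) := by
    rw [List.take_append_getElem]; exact hω.take _
  have hsuf : cs.IsReduced ((ω.drop (k + 1)).reverse ++ [ω[k]]) := by
    rw [← List.reverse_cons, ← List.drop_eq_getElem_cons]
    exact (hω.drop k).reverse
  rw [isReduced_concat_iff cs (hω.take k)] at hpre
  rw [isReduced_concat_iff cs (hω.drop (k + 1)).reverse, cs.wordProd_reverse] at hsuf
  have hy : cs.wordProd ω =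
      cs.wordProd (ω.take k) * (cs.simple ω[k] * cs.wordProd (ω.drop (k + 1))) := by
    conv_lhs => rw [hsplit, cs.wordProd_append, cs.wordProd_cons]
  rw [← hprod, List.eraseIdx_eq_take_drop_succ, cs.wordProd_append, hy]
  simp only [mul_inv_rev, r.act_mul_apply, cs.inv_simple, r.act_simple, map_sub, map_smul,
    smul_eq_mul]
  have := mul_pos (r.root_pos hv hpre) (r.coroot_pos hl hsuf)
  linarith

theorem weight_le_of_bruhatLE {v : V} (hv : ∀ s, 0 < r.α s v) {l : Module.Dual ℝ V}
    (hl : ∀ s, 0 < l (r.coα s)) {x y : W} (h : BruhatLE cs x y) :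
    l (r.act y⁻¹ v) ≤ l (r.act x⁻¹ v) ∧ (x ≠ y → l (r.act y⁻¹ v) < l (r.act x⁻¹ v)) := by
  induction h with
  | refl => simp
  | tail _ hstep ih =>
    obtain ⟨t, ht, rfl, hlt⟩ := hstep
    rename_i z _
    have h1 : cs.IsLeftInversion (t * z) t :=
      ⟨ht, by rwa [← mul_assoc, ht.mul_self, one_mul]⟩
    have h2 := r.weight_lt_of_isLeftInversion hv hl h1
    rw [← mul_assoc, ht.mul_self, one_mul] at h2
    exact ⟨(h2.trans_le ih.1).le, fun _ => h2.trans_le ih.1⟩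

theorem exists_dominant_weight : ∃ l : Module.Dual ℝ V, ∀ s, 0 < l (r.coα s) := by
  obtain ⟨l, hl⟩ := ((Module.Basis.span r.indep_coα).constr ℝ fun _ => (1 : ℝ)).exists_extend
  refine ⟨l, fun s => ?_⟩
  have h1 : r.coα s = (Module.Basis.span r.indep_coα s : V) := by
    rw [Module.Basis.span_apply]
  have h2 := LinearMap.congr_fun hl (Module.Basis.span r.indep_coα s)
  rw [Module.Basis.constr_basis] at h2
  rw [h1]
  exact lt_of_lt_of_eq one_pos h2.symm

end Realisation

section EquivariantMultiplicity

variable {cs : CoxeterSystem M W} (r : Realisation cs V)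

theorem eqMult_nil (x : W) (v : V) [Decidable (x = 1)] :
    eqMult cs r x [] v = if x = 1 then 1 else 0 := by
  classical
  simp only [eqMult, nilD, List.foldl_nil, Finsupp.single_apply]
  by_cases h : x = 1
  · simp [h]
  · simp [h, Ne.symm h]

theorem rightD_apply (c : W →₀ (V → ℝ)) (s : B) (x : W) (v : V) :
    rightD cs r c s x v =
      (c x v + c (x * cs.simple s) v) * (r.α s (r.act x⁻¹ v))⁻¹ := by
  classical
  have h1 : ∀ y : W, y * cs.simple s = x ↔ y = x * cs.simple s := fun y => by
    constructor
    · rintro rfl; simp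
    · rintro rfl; simp
  have h2 : ∀ z (a : V → ℝ), (if z ∈ c.support then fun v => c z v * a v else 0) =
      fun v => c z v * a v := by
    intro z a
    split_ifs with h
    · rfl
    · rw [Finsupp.notMem_support_iff.mp h]
      funext v
      simp
  simp only [rightD, Finsupp.sum, Finsupp.finsetSum_apply, Finsupp.sub_apply,
    Finsupp.single_apply, h1, Finset.sum_sub_distrib]
  rw [Finset.sum_ite_eq', Finset.sum_ite_eq', h2, h2, Pi.sub_apply, r.α_act_mul_simple_inv,
    inv_neg]
  ring

theorem eqMult_concat (ω : List B) (s : B) (x : W) (v : V) :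
    eqMult cs r x (ω ++ [s]) v =
      (eqMult cs r x ω v + eqMult cs r (x * cs.simple s) ω v) * (r.α s (r.act x⁻¹ v))⁻¹ := by
  rw [eqMult, nilD, List.foldl_append, List.foldl_cons, List.foldl_nil, rightD_apply]
  rfl

theorem bruhatLE_of_eqMult_ne_zero {ω : List B} (hω : cs.IsReduced ω) {x : W} {v : V}
    (h : eqMult cs r x ω v ≠ 0) : BruhatLE cs x (cs.wordProd ω) := by
  classical
  induction ω using List.reverseRecOn generalizing x with
  | nil =>
    rw [eqMult_nil] at h
    have hx : x = 1 := by by_contra hx; simp [hx] at h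
    rw [hx, cs.wordProd_nil]
    exact Relation.ReflTransGen.refl
  | append_singleton ω s ih =>
    have hpre := isReduced_of_concat cs hω
    have hup := bruhatLE_mul_simple ((isReduced_concat_iff cs hpre s).mp hω)
    rw [cs.wordProd_append, cs.wordProd_singleton]
    by_cases hx : eqMult cs r x ω v = 0
    · have hxs : eqMult cs r (x * cs.simple s) ω v ≠ 0 := by
        intro h0
        rw [eqMult_concat, hx, h0] at h
        simp at h
      have h1 := (ih hpre hxs).mul_simple s
      rw [cs.simple_mul_simple_cancel_right] at h1
      exact h1.elim (·.trans hup) id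
    · exact (ih hpre hx).trans hup

theorem leftInvSeq_concat_reduced_root {v : V} (hv : ∀ s, 0 < r.α s v) {ω : List B} {s : B}
    (h : cs.IsReduced (ω ++ [s])) :
    r.reflectionRoot v (cs.wordProd ω * cs.simple s * (cs.wordProd ω)⁻¹) =
      r.α s (r.act (cs.wordProd ω)⁻¹ v) :=
  r.reflectionRoot_eq hv ((isReduced_concat_iff cs (isReduced_of_concat cs h) s).mp h)

theorem leftInvSeq_append_singleton (ω : List B) (s : B) :
    cs.leftInvSeq (ω ++ [s]) =
      cs.leftInvSeq ω ++ [cs.wordProd ω * cs.simple s * (cs.wordProd ω)⁻¹] := by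
  rw [← List.concat_eq_append, cs.leftInvSeq_concat, List.concat_eq_append]

theorem eqMult_wordProd {v : V} (hv : ∀ s, 0 < r.α s v) {ω : List B} (hω : cs.IsReduced ω) :
    eqMult cs r (cs.wordProd ω) ω v =
      (-1) ^ ω.length * ((cs.leftInvSeq ω).map fun t => (r.reflectionRoot v t)⁻¹).prod := by
  classical
  induction ω using List.reverseRecOn with
  | nil => simp [eqMult_nil]
  | append_singleton ω s ih =>
    have hpre := isReduced_of_concat cs hω
    have hlt := (isReduced_concat_iff cs hpre s).mp hω
    have hz : eqMult cs r (cs.wordProd ω * cs.simple s) ω v = 0 := by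
      by_contra hne
      obtain ⟨l, hl⟩ := r.exists_dominant_weight
      have h2 := r.weight_le_of_bruhatLE hv hl (bruhatLE_of_eqMult_ne_zero r hpre hne)
      have h3 := r.weight_le_of_bruhatLE hv hl (bruhatLE_mul_simple hlt)
      have hne' : cs.wordProd ω ≠ cs.wordProd ω * cs.simple s := fun h => by
        rw [← h] at hlt
        exact lt_irrefl _ hlt
      linarith [h2.1, h3.2 hne']
    rw [eqMult_concat, cs.wordProd_append, cs.wordProd_singleton, cs.simple_mul_simple_cancel_right,
      hz, ih hpre, r.α_act_mul_simple_inv, leftInvSeq_append_singleton, List.map_append,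
      List.prod_append, List.map_singleton, List.prod_singleton,
      leftInvSeq_concat_reduced_root r hv hω, List.length_append, List.length_singleton, pow_succ,
      inv_neg]
    ring

/-- The coefficient of `D_{ty}` in the commutation relation between `D_y` and a weight `l`. -/
def chevalleyCoeff (v : V) (l : Module.Dual ℝ V) (y t : W) : ℝ :=
  (l (r.act (t * y)⁻¹ v) - l (r.act y⁻¹ v)) * (r.reflectionRoot v t)⁻¹

theorem chevalleyCoeff_mul_simple (v : V) (l : Module.Dual ℝ V) (y t : W) (s : B) :
    chevalleyCoeff r v l (y * cs.simple s) t =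
      chevalleyCoeff r v (l ∘ₗ r.act (cs.simple s)) y t := by
  simp only [chevalleyCoeff, ← mul_assoc, LinearMap.comp_apply, ← r.act_mul_apply]
  simp [mul_assoc]

theorem chevalleyCoeff_pos {v : V} (hv : ∀ s, 0 < r.α s v) {l : Module.Dual ℝ V}
    (hl : ∀ s, 0 < l (r.coα s)) {y t : W} (h : cs.IsLeftInversion y t) :
    0 < chevalleyCoeff r v l y t :=
  mul_pos (sub_pos.mpr (r.weight_lt_of_isLeftInversion hv hl h))
    (inv_pos.mpr (r.reflectionRoot_pos hv h.1))

/-- The nil Hecke commutation relation between `D_ω` and a weight, on the `δ_x`-coefficient. -/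
theorem weight_mul_eqMult {v : V} (hv : ∀ s, 0 < r.α s v) {ω : List B} (hω : cs.IsReduced ω)
    (l : Module.Dual ℝ V) (x : W) :
    l (r.act x⁻¹ v) * eqMult cs r x ω v =
      l (r.act (cs.wordProd ω)⁻¹ v) * eqMult cs r x ω v +
        ∑ k ∈ Finset.range ω.length,
          chevalleyCoeff r v l (cs.wordProd ω) ((cs.leftInvSeq ω).getD k 1) *
            eqMult cs r x (ω.eraseIdx k) v := by
  classical
  induction ω using List.reverseRecOn generalizing l x with
  | nil =>
    by_cases hx : x = 1 <;> simp [eqMult_nil, hx]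
  | append_singleton ω s ih =>
    have hpre := isReduced_of_concat cs hω
    set y := cs.wordProd ω with hy
    have hroot : r.reflectionRoot v (y * cs.simple s * y⁻¹) = r.α s (r.act y⁻¹ v) :=
      leftInvSeq_concat_reduced_root r hv hω
    have hys : cs.wordProd (ω ++ [s]) = y * cs.simple s := by
      rw [cs.wordProd_append, cs.wordProd_singleton]
    have hlis : cs.leftInvSeq (ω ++ [s]) = cs.leftInvSeq ω ++ [y * cs.simple s * y⁻¹] :=
      leftInvSeq_append_singleton ω s
    have hlast : chevalleyCoeff r v l (y * cs.simple s) (y * cs.simple s * y⁻¹) = l (r.coα s) := by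
      have hne := r.root_ne_zero hv y s
      have h1 : y * cs.simple s * y⁻¹ * (y * cs.simple s) = y := by simp [mul_assoc]
      rw [chevalleyCoeff, hroot, h1, r.act_mul_simple_inv, map_sub, map_smul, smul_eq_mul]
      field_simp
      ring
    have hterm : ∀ k ∈ Finset.range ω.length,
        chevalleyCoeff r v l (y * cs.simple s) ((cs.leftInvSeq (ω ++ [s])).getD k 1) *
          eqMult cs r x ((ω ++ [s]).eraseIdx k) v =
        (chevalleyCoeff r v (l ∘ₗ r.act (cs.simple s)) y ((cs.leftInvSeq ω).getD k 1) *
          eqMult cs r x (ω.eraseIdx k) v +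
         chevalleyCoeff r v (l ∘ₗ r.act (cs.simple s)) y ((cs.leftInvSeq ω).getD k 1) *
          eqMult cs r (x * cs.simple s) (ω.eraseIdx k) v) * (r.α s (r.act x⁻¹ v))⁻¹ := by
      intro k hk
      have hk' := Finset.mem_range.mp hk
      rw [List.eraseIdx_append_of_lt_length hk', eqMult_concat, chevalleyCoeff_mul_simple, hlis,
        List.getD_append _ _ _ _ (by rw [cs.length_leftInvSeq]; exact hk')]
      ring
    have h1 := ih hpre (l ∘ₗ r.act (cs.simple s)) x
    have h2 := ih hpre (l ∘ₗ r.act (cs.simple s)) (x * cs.simple s)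
    have hne := r.root_ne_zero hv x s
    rw [hys, List.length_append, List.length_singleton, Finset.sum_range_succ,
      Finset.sum_congr rfl hterm, ← Finset.sum_mul, Finset.sum_add_distrib,
      List.eraseIdx_append_of_length_le le_rfl, hlis,
      List.getD_append_right _ _ _ _ (by rw [cs.length_leftInvSeq]), cs.length_leftInvSeq,
      Nat.sub_self, List.getD_cons_zero, hlast, List.eraseIdx_cons_zero, List.append_nil,
      eqMult_concat, eq_sub_of_add_eq' h1.symm, eq_sub_of_add_eq' h2.symm]
    simp only [LinearMap.comp_apply, r.act_mul_simple_inv, r.act_simple, map_sub, map_smul,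
      smul_eq_mul, r.pairing_self]
    field_simp
    ring

theorem eqMult_concat_concat {v : V} (hv : ∀ s, 0 < r.α s v) (ω : List B) (s : B) (x : W) :
    eqMult cs r x (ω ++ [s] ++ [s]) v = 0 := by
  have hne := r.root_ne_zero hv x s
  rw [eqMult_concat, eqMult_concat r ω, eqMult_concat r ω, r.α_act_mul_simple_inv,
    cs.simple_mul_simple_cancel_right, inv_neg]
  ring

theorem perm_leftInvSeq {ω ω' : List B} (hω : cs.IsReduced ω) (hω' : cs.IsReduced ω')
    (h : cs.wordProd ω = cs.wordProd ω') : (cs.leftInvSeq ω).Perm (cs.leftInvSeq ω') := by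
  rw [List.perm_ext_iff_of_nodup hω.nodup_leftInvSeq hω'.nodup_leftInvSeq]
  intro t
  constructor
  · intro ht
    have := cs.isLeftInversion_of_mem_leftInvSeq hω ht
    exact mem_leftInvSeq_of_isLeftInversion cs (h ▸ this)
  · intro ht
    have := cs.isLeftInversion_of_mem_leftInvSeq hω' ht
    exact mem_leftInvSeq_of_isLeftInversion cs (h ▸ this)

theorem sum_range_getD_leftInvSeq (G : W → ℝ) (ω : List B) :
    ∑ k ∈ Finset.range ω.length, G ((cs.leftInvSeq ω).getD k 1) =
      ((cs.leftInvSeq ω).map G).sum := by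
  have h : ∀ L : List W, ∑ k ∈ Finset.range L.length, G (L.getD k 1) = (L.map G).sum := by
    intro L
    induction L with
    | nil => simp
    | cons a L ih =>
      rw [List.length_cons, Finset.sum_range_succ', List.map_cons, List.sum_cons, ← ih, add_comm]
      simp
  rw [← h, cs.length_leftInvSeq]

/-- `D_ω` vanishes for non-reduced `ω`, and depends only on the group element for reduced `ω`. -/
theorem eqMult_nonreduced_and_wellDefined {v : V} (hv : ∀ s, 0 < r.α s v) (ω : List B) :
    (¬ cs.IsReduced ω → ∀ x, eqMult cs r x ω v = 0) ∧
      (cs.IsReduced ω → ∀ ω', cs.IsReduced ω' → cs.wordProd ω = cs.wordProd ω' →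
        ∀ x, eqMult cs r x ω v = eqMult cs r x ω' v) := by
  classical
  induction hn : ω.length using Nat.strong_induction_on generalizing ω with
  | _ n ih =>
  subst hn
  constructor
  · intro hnr x
    rcases List.eq_nil_or_concat ω with rfl | ⟨ω₁, s, rfl⟩
    · exact absurd (by simp [CoxeterSystem.IsReduced]) hnr
    rw [List.concat_eq_append] at hnr ih ⊢
    obtain ⟨ih1, ih2⟩ := ih ω₁.length (by simp) ω₁ rfl
    by_cases hred : cs.IsReduced ω₁
    · rw [isReduced_concat_iff cs hred] at hnr
      obtain ⟨ω₂, h2, hprod⟩ := cs.exists_isReduced (cs.wordProd ω₁ * cs.simple s)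
      have hprod' : cs.wordProd ω₁ = cs.wordProd (ω₂ ++ [s]) := by
        rw [cs.wordProd_append, cs.wordProd_singleton, ← hprod, cs.simple_mul_simple_cancel_right]
      have hred2 : cs.IsReduced (ω₂ ++ [s]) := by
        rw [isReduced_concat_iff cs h2, ← hprod, cs.simple_mul_simple_cancel_right]
        exact lt_of_le_of_ne (not_lt.mp hnr) (cs.length_mul_simple_ne _ s)
      have h3 := ih2 hred _ hred2 hprod'
      rw [eqMult_concat, h3, h3, ← eqMult_concat]
      exact eqMult_concat_concat r hv ω₂ s x
    · rw [eqMult_concat, ih1 hred, ih1 hred]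
      simp
  · intro hω ω' hω' heq x
    set y := cs.wordProd ω with hy
    have hlen : ω'.length = ω.length := by rw [← hω'.eq, ← heq, ← hω.eq]
    have hperm := perm_leftInvSeq hω hω' heq
    by_cases hxy : x = y
    · rw [hxy, hy, eqMult_wordProd r hv hω, ← hy, heq, eqMult_wordProd r hv hω', hlen,
        (hperm.map _).prod_eq]
    by_contra hne
    have hle : BruhatLE cs x y := by
      by_contra hnle
      have h0 : eqMult cs r x ω v = 0 := by
        by_contra h
        exact hnle (bruhatLE_of_eqMult_ne_zero r hω h)
      have h0' : eqMult cs r x ω' v = 0 := by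
        by_contra h
        exact hnle (heq ▸ bruhatLE_of_eqMult_ne_zero r hω' h)
      exact hne (h0.trans h0'.symm)
    obtain ⟨l, hl⟩ := r.exists_dominant_weight
    have hlt := (r.weight_le_of_bruhatLE hv hl hle).2 hxy
    set G : W → ℝ := fun t => if cs.length (t * y) + 1 = ω.length then
      chevalleyCoeff r v l y t * eqMult cs r x (cs.exists_isReduced (t * y)).choose v else 0 with hG
    have key : ∀ ω₀ : List B, cs.IsReduced ω₀ → cs.wordProd ω₀ = y → ω₀.length = ω.length →
        ∀ k ∈ Finset.range ω₀.length,
          chevalleyCoeff r v l (cs.wordProd ω₀) ((cs.leftInvSeq ω₀).getD k 1) *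
            eqMult cs r x (ω₀.eraseIdx k) v =
          G ((cs.leftInvSeq ω₀).getD k 1) := by
      intro ω₀ h0 h0y h0len k hk
      have hk' := Finset.mem_range.mp hk
      have hlen' := List.length_eraseIdx_add_one hk'
      have hprod := cs.getD_leftInvSeq_mul_wordProd ω₀ k
      rw [h0y] at hprod ⊢
      obtain ⟨ih1, ih2⟩ := ih (ω₀.eraseIdx k).length (by omega) _ rfl
      simp only [hG]
      split_ifs with hif
      · have hred : cs.IsReduced (ω₀.eraseIdx k) := by
          rw [CoxeterSystem.IsReduced, ← hprod]
          omega
        have hspec := (cs.exists_isReduced ((cs.leftInvSeq ω₀).getD k 1 * y)).choose_spec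
        rw [ih2 hred _ hspec.1 (hprod.symm.trans hspec.2)]
      · have hred : ¬ cs.IsReduced (ω₀.eraseIdx k) := by
          intro hred
          have := hred.eq
          rw [← hprod] at this
          omega
        rw [ih1 hred, mul_zero]
    have e1 := weight_mul_eqMult r hv hω l x
    have e2 := weight_mul_eqMult r hv hω' l x
    rw [Finset.sum_congr rfl (key ω hω rfl rfl), sum_range_getD_leftInvSeq G ω] at e1
    rw [Finset.sum_congr rfl (key ω' hω' heq.symm hlen), sum_range_getD_leftInvSeq G ω',
      ← (hperm.map _).sum_eq, ← heq] at e2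
    apply hne
    have h3 : (l (r.act x⁻¹ v) - l (r.act y⁻¹ v)) *
        (eqMult cs r x ω v - eqMult cs r x ω' v) = 0 := by
      linear_combination e1 - e2
    exact sub_eq_zero.mp ((mul_eq_zero.mp h3).resolve_left (sub_pos.mpr hlt).ne')

theorem eqMult_eq_zero_of_not_isReduced {v : V} (hv : ∀ s, 0 < r.α s v) {ω : List B}
    (hω : ¬ cs.IsReduced ω) (x : W) : eqMult cs r x ω v = 0 :=
  (eqMult_nonreduced_and_wellDefined r hv ω).1 hω x

theorem neg_one_pow_mul_eqMult_wordProd_pos {v : V} (hv : ∀ s, 0 < r.α s v) {ω : List B}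
    (hω : cs.IsReduced ω) :
    0 < (-1 : ℝ) ^ cs.length (cs.wordProd ω) * eqMult cs r (cs.wordProd ω) ω v := by
  rw [eqMult_wordProd r hv hω, hω.eq, ← mul_assoc, ← mul_pow]
  simp only [mul_neg, mul_one, neg_neg, one_pow, one_mul]
  apply List.prod_pos
  intro a ha
  obtain ⟨t, ht, rfl⟩ := List.mem_map.mp ha
  exact inv_pos.mpr (r.reflectionRoot_pos hv (cs.isReflection_of_mem_leftInvSeq ω ht))

theorem neg_one_pow_mul_eqMult_pos {v : V} (hv : ∀ s, 0 < r.α s v) {ω : List B}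
    (hω : cs.IsReduced ω) {x : W} (hle : BruhatLE cs x (cs.wordProd ω)) :
    0 < (-1 : ℝ) ^ cs.length x * eqMult cs r x ω v := by
  induction hn : ω.length using Nat.strong_induction_on generalizing ω with
  | _ n ih =>
  subst hn
  by_cases hxy : x = cs.wordProd ω
  · rw [hxy]
    exact neg_one_pow_mul_eqMult_wordProd_pos r hv hω
  obtain ⟨l, hl⟩ := r.exists_dominant_weight
  have hlt := (r.weight_le_of_bruhatLE hv hl hle).2 hxy
  have hinv : ∀ k ∈ Finset.range ω.length,
      0 < chevalleyCoeff r v l (cs.wordProd ω) ((cs.leftInvSeq ω).getD k 1) := fun k hk => by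
    have hk' : k < (cs.leftInvSeq ω).length := by simpa using hk
    apply chevalleyCoeff_pos r hv hl
    rw [List.getD_eq_getElem _ _ hk']
    exact cs.isLeftInversion_of_mem_leftInvSeq hω (List.getElem_mem hk')
  have hnonneg : ∀ k ∈ Finset.range ω.length,
      0 ≤ (-1 : ℝ) ^ cs.length x * eqMult cs r x (ω.eraseIdx k) v := fun k hk => by
    have hlen := List.length_eraseIdx_add_one (Finset.mem_range.mp hk)
    by_cases hred : cs.IsReduced (ω.eraseIdx k)
    · by_cases h0 : eqMult cs r x (ω.eraseIdx k) v = 0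
      · rw [h0, mul_zero]
      · exact (ih _ (by omega) hred (bruhatLE_of_eqMult_ne_zero r hred h0) rfl).le
    · rw [eqMult_eq_zero_of_not_isReduced r hv hred, mul_zero]
  obtain ⟨t, ht, hcov, hxt⟩ := hle.exists_covered hxy
  obtain ⟨k, hk, -, hprod⟩ :=
    exists_eraseIdx_of_isLeftInversion cs (ω := ω) (t := t) ⟨ht, by omega⟩
  have hkpos : 0 < (-1 : ℝ) ^ cs.length x * eqMult cs r x (ω.eraseIdx k) v := by
    have hlen := List.length_eraseIdx_add_one hk
    refine ih (ω.eraseIdx k).length (by omega) ?_ (hprod ▸ hxt) rfl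
    have := hω.eq
    rw [CoxeterSystem.IsReduced, hprod]
    omega
  have hsum : 0 < ∑ k ∈ Finset.range ω.length,
      chevalleyCoeff r v l (cs.wordProd ω) ((cs.leftInvSeq ω).getD k 1) *
        ((-1 : ℝ) ^ cs.length x * eqMult cs r x (ω.eraseIdx k) v) :=
    Finset.sum_pos' (fun j hj => mul_nonneg (hinv j hj).le (hnonneg j hj))
      ⟨k, Finset.mem_range.mpr hk, mul_pos (hinv k (Finset.mem_range.mpr hk)) hkpos⟩
  have hcomm := weight_mul_eqMult r hv hω l x
  have heq : (l (r.act x⁻¹ v) - l (r.act (cs.wordProd ω)⁻¹ v)) *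
      ((-1 : ℝ) ^ cs.length x * eqMult cs r x ω v) =
      ∑ k ∈ Finset.range ω.length,
        chevalleyCoeff r v l (cs.wordProd ω) ((cs.leftInvSeq ω).getD k 1) *
          ((-1 : ℝ) ^ cs.length x * eqMult cs r x (ω.eraseIdx k) v) := by
    simp only [mul_left_comm _ ((-1 : ℝ) ^ cs.length x), ← Finset.mul_sum]
    linear_combination (-1 : ℝ) ^ cs.length x * hcomm
  rw [← heq] at hsum
  exact (mul_pos_iff_of_pos_left (sub_pos.mpr hlt)).mp hsum

end EquivariantMultiplicity

/-- Let `ρ^∨ ∈ 𝔥` be dominant (`⟨α_s, ρ^∨⟩ > 0` for all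
`s ∈ S`) and let `σ : Q → ℝ[z, z⁻¹]` be the specialisation determined by
`λ ↦ ⟨λ, ρ^∨⟩ z` on degree-2 elements.  If `x ≤ y` in the Bruhat order then
`(-1)^{ℓ(x)} σ(e_{x,y})` is positive: since `e_{x,y}` is homogeneous of
degree `-2 ℓ(y)` we have `σ(e_{x,y}) = a · z^{-ℓ(y)}` with
`a = e_{x,y}(ρ^∨)`, and the claim is `(-1)^{ℓ(x)} · e_{x,y}(ρ^∨) > 0`. -/
theorem statement3 (cs : CoxeterSystem M W)
    (V : Type) [AddCommGroup V] [Module ℝ V] [FiniteDimensional ℝ V]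
    (r : Realisation cs V)
    (ρv : V) (hdom : ∀ s : B, 0 < r.α s ρv)
    (x : W) (ω : List B) (hred : cs.IsReduced ω)
    (hle : BruhatLE cs x (cs.wordProd ω)) :
    0 < (-1 : ℝ) ^ cs.length x * eqMult cs r x ω ρv := by
  exact neg_one_pow_mul_eqMult_pos r hdom hred hle
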